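/- arXiv:0904.0539 — 3 statements merged into one kernel-verified Lean document; each statement's English description precedes it below -/
import Mathlib

section
/- The conditions d = c, e = c−1, and both N(e) and N(12) unitary hold if and only if there exist real numbers θ, φ, ψ such that a = e^{iφ}/√(1+8cos²(θ−φ)), b = −2cos(θ−φ)·e^{iθ}/√(1+8cos²(θ−φ)), c = (2/3)·e^{iψ}·cos ψ, d = c, and e = c−1. (These are exactly the torsion-free star-compatible connections on the function algebra of S₃.) -/
open Complex

noncomputable section

/-- The matrix `N(e) = [[a,b,b],[b,a,b],[b,b,a]]`. -/
def Nid (a b : ℂ) : Matrix (Fin 3) (Fin 3) ℂ := !![a, b, b; b, a, b; b, b, a]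

/-- The matrix `N(12) = [[d,e,c],[c,d,e],[e,c,d]]`. -/
def Ntr (c d e : ℂ) : Matrix (Fin 3) (Fin 3) ℂ := !![d, e, c; c, d, e; e, c, d]

/-- `N(e)` is unitary iff `|a|² + 2|b|² = 1` and `2 Re(a b̄) + |b|² = 0`. -/
theorem Nid_mem_unitaryGroup_iff (a b : ℂ) :
    Nid a b ∈ Matrix.unitaryGroup (Fin 3) ℂ ↔
      a.re ^ 2 + a.im ^ 2 + 2 * (b.re ^ 2 + b.im ^ 2) = 1 ∧
        2 * (a.re * b.re + a.im * b.im) + (b.re ^ 2 + b.im ^ 2) = 0 := by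
  rw [Matrix.mem_unitaryGroup_iff]
  constructor
  · intro h
    have h00 := congrArg Complex.re (congrFun (congrFun h 0) 0)
    have h01 := congrArg Complex.re (congrFun (congrFun h 0) 1)
    simp [Nid, Matrix.mul_apply, Fin.sum_univ_three, Matrix.star_apply] at h00 h01
    constructor <;> linarith
  · rintro ⟨h₁, h₂⟩
    ext i j
    fin_cases i <;> fin_cases j <;>
      simp [Nid, Matrix.mul_apply, Fin.sum_univ_three, Matrix.star_apply, Complex.ext_iff] <;>
      constructor <;> linarith

/-- In the torsion-free case `N(12)` is unitary iff `3|c|² = 2 Re c`. -/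
theorem Ntr_self_mem_unitaryGroup_iff (c : ℂ) :
    Ntr c c (c - 1) ∈ Matrix.unitaryGroup (Fin 3) ℂ ↔
      3 * (c.re ^ 2 + c.im ^ 2) = 2 * c.re := by
  rw [Matrix.mem_unitaryGroup_iff]
  constructor
  · intro h
    have h00 := congrArg Complex.re (congrFun (congrFun h 0) 0)
    simp [Ntr, Matrix.mul_apply, Fin.sum_univ_three, Matrix.star_apply] at h00
    linarith
  · intro h
    ext i j
    fin_cases i <;> fin_cases j <;>
      simp [Ntr, Matrix.mul_apply, Fin.sum_univ_three, Matrix.star_apply, Complex.ext_iff] <;>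
      constructor <;> linarith

/-- The circle `3|c|² = 2 Re c` is parametrized by `c = (2/3) e^{iψ} cos ψ`. -/
theorem three_mul_normSq_eq_two_mul_re_iff (c : ℂ) :
    3 * (c.re ^ 2 + c.im ^ 2) = 2 * c.re ↔
      ∃ ψ : ℝ, c = (2 : ℂ) / 3 * Complex.exp (ψ * I) * (Real.cos ψ : ℝ) := by
  constructor
  · intro h
    by_cases hc : c = 0
    · exact ⟨Real.pi / 2, by simp [hc]⟩
    have hpos : 0 < ‖c‖ := norm_pos_iff.mpr hc
    have hre := Complex.norm_mul_cos_arg c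
    have hsq := Complex.sq_norm c
    rw [Complex.normSq_apply] at hsq
    have hnorm : ‖c‖ = 2 / 3 * Real.cos c.arg := by
      apply mul_left_cancel₀ hpos.ne'
      linarith
    refine ⟨c.arg, ?_⟩
    conv_lhs => rw [← Complex.norm_mul_exp_arg_mul_I c, hnorm]
    push_cast
    ring
  · rintro ⟨ψ, rfl⟩
    have hre : ((2 : ℂ) / 3 * Complex.exp (ψ * I) * (Real.cos ψ : ℝ)).re
        = 2 / 3 * Real.cos ψ * Real.cos ψ := by
      rw [show (2 : ℂ) / 3 * Complex.exp (ψ * I) * (Real.cos ψ : ℝ)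
        = ((2 / 3 * Real.cos ψ : ℝ) : ℂ) * Complex.exp (ψ * I) by push_cast; ring,
        Complex.re_ofReal_mul, Complex.exp_ofReal_mul_I_re]
    have him : ((2 : ℂ) / 3 * Complex.exp (ψ * I) * (Real.cos ψ : ℝ)).im
        = 2 / 3 * Real.cos ψ * Real.sin ψ := by
      rw [show (2 : ℂ) / 3 * Complex.exp (ψ * I) * (Real.cos ψ : ℝ)
        = ((2 / 3 * Real.cos ψ : ℝ) : ℂ) * Complex.exp (ψ * I) by push_cast; ring,
        Complex.im_ofReal_mul, Complex.exp_ofReal_mul_I_im]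
    rw [hre, him]
    linear_combination (4 / 3 * Real.cos ψ ^ 2) * Real.sin_sq_add_cos_sq ψ

/-- If `2 Re(a b̄) + |b|² = 0`, then `b = -2 |a| cos(θ - arg a) e^{iθ}` for some `θ`. -/
theorem exists_eq_neg_two_mul_norm_mul_cos (a b : ℂ)
    (h : 2 * (a.re * b.re + a.im * b.im) + (b.re ^ 2 + b.im ^ 2) = 0) :
    ∃ θ : ℝ, b = ((-(2 * ‖a‖ * Real.cos (θ - a.arg)) : ℝ) : ℂ) * Complex.exp (θ * I) := by
  by_cases hb : b = 0
  · exact ⟨a.arg + Real.pi / 2, by simp [hb]⟩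
  have hpos : 0 < ‖b‖ := norm_pos_iff.mpr hb
  have hsq := Complex.sq_norm b
  rw [Complex.normSq_apply] at hsq
  have hnorm : ‖b‖ = -(2 * ‖a‖ * Real.cos (b.arg - a.arg)) := by
    apply mul_left_cancel₀ hpos.ne'
    rw [Real.cos_sub]
    linear_combination hsq + h + 2 * b.re * Complex.norm_mul_cos_arg a
      + 2 * b.im * Complex.norm_mul_sin_arg a
      + 2 * (‖a‖ * Real.cos a.arg) * Complex.norm_mul_cos_arg b
      + 2 * (‖a‖ * Real.sin a.arg) * Complex.norm_mul_sin_arg b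
  exact ⟨b.arg, by rw [← hnorm, Complex.norm_mul_exp_arg_mul_I]⟩

/-- Trigonometric parametrization of the unitary matrices `N(e)`. -/
theorem Nid_mem_unitaryGroup_iff_exists (a b : ℂ) :
    Nid a b ∈ Matrix.unitaryGroup (Fin 3) ℂ ↔
      ∃ θ φ : ℝ,
        a = Complex.exp (φ * I) / (Real.sqrt (1 + 8 * Real.cos (θ - φ) ^ 2) : ℝ) ∧
        b = -(2 * Real.cos (θ - φ) : ℝ) * Complex.exp (θ * I) /
              (Real.sqrt (1 + 8 * Real.cos (θ - φ) ^ 2) : ℝ) := by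
  rw [Nid_mem_unitaryGroup_iff]
  constructor
  · rintro ⟨h₁, h₂⟩
    obtain ⟨θ, hθ⟩ := exists_eq_neg_two_mul_norm_mul_cos a b h₂
    set k := Real.cos (θ - a.arg) with hk
    have hasq := Complex.sq_norm a
    rw [Complex.normSq_apply] at hasq
    have hre : b.re = -(2 * ‖a‖ * k) * Real.cos θ := by
      rw [hθ, Complex.re_ofReal_mul, Complex.exp_ofReal_mul_I_re]
    have him : b.im = -(2 * ‖a‖ * k) * Real.sin θ := by
      rw [hθ, Complex.im_ofReal_mul, Complex.exp_ofReal_mul_I_im]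
    have hone : ‖a‖ ^ 2 * (1 + 8 * k ^ 2) = 1 := by
      rw [hre, him] at h₁
      linear_combination h₁ + hasq - 8 * ‖a‖ ^ 2 * k ^ 2 * Real.sin_sq_add_cos_sq θ
    have hnorm : ‖a‖ = (Real.sqrt (1 + 8 * k ^ 2))⁻¹ := by
      rw [← Real.sqrt_inv, ← eq_inv_of_mul_eq_one_left hone, Real.sqrt_sq (norm_nonneg a)]
    refine ⟨θ, a.arg, ?_, ?_⟩
    · conv_lhs => rw [← Complex.norm_mul_exp_arg_mul_I a, hnorm]
      rw [← hk]
      push_cast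
      ring
    · rw [hθ, hnorm, ← hk]
      push_cast
      ring
  · rintro ⟨θ, φ, ha, hb⟩
    set k := Real.cos (θ - φ) with hk
    set s := Real.sqrt (1 + 8 * k ^ 2) with hs
    have hs_sq : (s⁻¹) ^ 2 * (1 + 8 * k ^ 2) = 1 := by
      have hpos : 0 < 1 + 8 * k ^ 2 := by positivity
      rw [inv_pow, hs, Real.sq_sqrt hpos.le, inv_mul_cancel₀ hpos.ne']
    have ha' : a = ((s⁻¹ : ℝ) : ℂ) * Complex.exp (φ * I) := by
      rw [ha]
      push_cast
      ring
    have hb' : b = ((-(2 * k * s⁻¹) : ℝ) : ℂ) * Complex.exp (θ * I) := by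
      rw [hb]
      push_cast
      ring
    rw [ha', hb']
    simp only [Complex.re_ofReal_mul, Complex.im_ofReal_mul, Complex.exp_ofReal_mul_I_re,
      Complex.exp_ofReal_mul_I_im]
    rw [Real.cos_sub] at hk
    constructor
    · linear_combination hs_sq + (s⁻¹) ^ 2 * Real.sin_sq_add_cos_sq φ
        + 8 * k ^ 2 * (s⁻¹) ^ 2 * Real.sin_sq_add_cos_sq θ
    · linear_combination 4 * k * (s⁻¹) ^ 2 * hk
        + 4 * k ^ 2 * (s⁻¹) ^ 2 * Real.sin_sq_add_cos_sq θ

/-- The torsion-free star-compatible connections on the function algebra of `S₃`: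
`d = c`, `e = c−1` and `N(e)`, `N(12)` unitary hold iff the parameters have the stated
trigonometric form. -/
theorem torsionFree_starCompatible_iff (a b c d e : ℂ) :
    (d = c ∧ e = c - 1 ∧
        Nid a b ∈ Matrix.unitaryGroup (Fin 3) ℂ ∧
        Ntr c d e ∈ Matrix.unitaryGroup (Fin 3) ℂ) ↔
      ∃ θ φ ψ : ℝ,
        a = Complex.exp (φ * I) / (Real.sqrt (1 + 8 * Real.cos (θ - φ) ^ 2) : ℝ) ∧
        b = -(2 * Real.cos (θ - φ) : ℝ) * Complex.exp (θ * I) /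
              (Real.sqrt (1 + 8 * Real.cos (θ - φ) ^ 2) : ℝ) ∧
        c = (2 : ℂ) / 3 * Complex.exp (ψ * I) * (Real.cos ψ : ℝ) ∧
        d = c ∧ e = c - 1 := by
  constructor
  · rintro ⟨rfl, rfl, h₁, h₂⟩
    obtain ⟨θ, φ, ha, hb⟩ := (Nid_mem_unitaryGroup_iff_exists a b).mp h₁
    rw [Ntr_self_mem_unitaryGroup_iff, three_mul_normSq_eq_two_mul_re_iff] at h₂
    obtain ⟨ψ, hc⟩ := h₂
    exact ⟨θ, φ, ψ, ha, hb, hc, rfl, rfl⟩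
  · rintro ⟨θ, φ, ψ, ha, hb, hc, rfl, rfl⟩
    refine ⟨rfl, rfl, (Nid_mem_unitaryGroup_iff_exists a b).mpr ⟨θ, φ, ha, hb⟩, ?_⟩
    rw [Ntr_self_mem_unitaryGroup_iff, three_mul_normSq_eq_two_mul_re_iff]
    exact ⟨ψ, hc⟩

end
end

section
/- Let q be real with q ≠ 0 and q² ≠ 1, let g₊₊, g₀₀, g₋₋ > 0, let disc = (g₀₀q²(1−q²))² + (g₊₊+g₋₋)² + 2g₀₀q²(1−q²)(g₋₋−g₊₊) > 0, and let √disc denote its positive square root. For real n₊ with 1 + (1−q²)n₊ ≠ 0, set m₊ = q⁴n₊ − (1+q²), n₋ = −n₊/(1+(1−q²)n₊), and m₋ = q⁻⁴(n₋ + 1 + q²). Then g₋₋·m₋ − g₊₊·m₊ − q²·g₀₀ = 0 holds if and only if n₊(1−q²) = −1 − (g₋₋ − g₊₊ + g₀₀q²(1−q²) + ε·√disc)/(2q⁴g₊₊) for some ε ∈ {1,−1}. -/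
/-- Clearing denominators, the vanishing of the torsion is a quadratic equation in
`y = q⁴(1 + (1−q²)n₊)`. -/
lemma torsion_zero_iff_quadratic {q gpp g00 gmm np : ℝ} (hq : q ≠ 0) (hq2 : q ^ 2 ≠ 1)
    (hdenom : 1 + (1 - q ^ 2) * np ≠ 0) :
    gmm * ((q ^ 4)⁻¹ * (-np / (1 + (1 - q ^ 2) * np) + 1 + q ^ 2)) -
          gpp * (q ^ 4 * np - (1 + q ^ 2)) - q ^ 2 * g00 = 0 ↔
      gpp * (q ^ 4 * (1 + (1 - q ^ 2) * np) * (q ^ 4 * (1 + (1 - q ^ 2) * np))) +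
        (gmm - gpp + g00 * q ^ 2 * (1 - q ^ 2)) * (q ^ 4 * (1 + (1 - q ^ 2) * np)) + -gmm = 0 := by
  have hs : 1 - q ^ 2 ≠ 0 := sub_ne_zero.mpr hq2.symm
  have hscale : -(q ^ 4 * (1 - q ^ 2) * (1 + (1 - q ^ 2) * np)) ≠ 0 :=
    neg_ne_zero.mpr (mul_ne_zero (mul_ne_zero (pow_ne_zero 4 hq) hs) hdenom)
  rw [← mul_eq_zero_iff_left hscale]
  refine Eq.congr_left ?_
  field_simp
  ring

/-- For the metric-preserving, torsion-compatible, star-compatible family of connections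
on `ℂ_q[SU₂]` with diagonal metric `(g₊₊, g₀₀, g₋₋)`, the remaining torsion `T(e⁰)`
vanishes, i.e. `g₋₋m₋ − g₊₊m₊ − q²g₀₀ = 0`, iff
`n₊(1−q²) = −1 − (g₋₋ − g₊₊ + g₀₀q²(1−q²) ± √disc)/(2q⁴g₊₊)`. -/
theorem torsion_zero_iff (q gpp g00 gmm np nm mp mm : ℝ)
    (hq : q ≠ 0) (hq2 : q ^ 2 ≠ 1)
    (hgpp : 0 < gpp) (hg00 : 0 < g00) (hgmm : 0 < gmm)
    (hdenom : 1 + (1 - q ^ 2) * np ≠ 0)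
    (hmp : mp = q ^ 4 * np - (1 + q ^ 2))
    (hnm : nm = -np / (1 + (1 - q ^ 2) * np))
    (hmm : mm = (q ^ 4)⁻¹ * (nm + 1 + q ^ 2)) :
    gmm * mm - gpp * mp - q ^ 2 * g00 = 0 ↔
      ∃ ε : ℝ, (ε = 1 ∨ ε = -1) ∧
        np * (1 - q ^ 2) =
          -1 - (gmm - gpp + g00 * q ^ 2 * (1 - q ^ 2) +
              ε * Real.sqrt ((g00 * q ^ 2 * (1 - q ^ 2)) ^ 2 + (gpp + gmm) ^ 2 +
                2 * (g00 * q ^ 2 * (1 - q ^ 2)) * (gmm - gpp))) /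
            (2 * q ^ 4 * gpp) := by
  subst hmp hnm hmm
  have hgpp0 : gpp ≠ 0 := hgpp.ne'
  rw [torsion_zero_iff_quadratic hq hq2 hdenom]
  set D := (g00 * q ^ 2 * (1 - q ^ 2)) ^ 2 + (gpp + gmm) ^ 2 +
    2 * (g00 * q ^ 2 * (1 - q ^ 2)) * (gmm - gpp) with hD
  have hdiscrim : discrim gpp (gmm - gpp + g00 * q ^ 2 * (1 - q ^ 2)) (-gmm) = D := by
    rw [hD, discrim]
    ring
  have hDnonneg : 0 ≤ D := by
    rw [← hdiscrim, discrim]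
    nlinarith [mul_pos hgpp hgmm, sq_nonneg (gmm - gpp + g00 * q ^ 2 * (1 - q ^ 2))]
  have root_iff (r : ℝ) :
      q ^ 4 * (1 + (1 - q ^ 2) * np) =
          (-(gmm - gpp + g00 * q ^ 2 * (1 - q ^ 2)) - r) / (2 * gpp) ↔
        np * (1 - q ^ 2) =
          -1 - (gmm - gpp + g00 * q ^ 2 * (1 - q ^ 2) + r) / (2 * q ^ 4 * gpp) := by
    rw [← sub_eq_zero, ← mul_eq_zero_iff_left (inv_ne_zero (pow_ne_zero 4 hq)),
      ← sub_eq_zero (a := np * (1 - q ^ 2))]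
    refine Eq.congr_left ?_
    field_simp
    ring
  rw [quadratic_eq_zero_iff hgpp0 (hdiscrim.trans (Real.mul_self_sqrt hDnonneg).symm), or_comm,
    root_iff,
    ← sub_neg_eq_add (-(gmm - gpp + g00 * q ^ 2 * (1 - q ^ 2))) (√D), root_iff]
  simp only [or_and_right, exists_or, exists_eq_left, one_mul, neg_mul]
end

section
/- Let g₊₊, g₀₀, g₋₋ be positive reals. Consider complex numbers n₊, n₋, m₊, m₋, r, ν, μ subject to: (star preservation) r = −conj(r), n₋ = −conj(n₊), m₋ = −conj(m₊), ν = −conj(μ); (metric preservation) n₊, n₋, r ∈ ℝ, g₊₊·conj(m₊) = g₀₀·μ, g₀₀·conj(ν) = g₋₋·m₋; (torsion freeness) m₊ − n₊ + 2 = 0, m₋ − n₋ − 2 = 0, ν − μ − 1 = 0. Then a solution exists if and only if g₊₊ = g₋₋, and in that case the solution is unique, given by r = 0, ν = 1/2, μ = −1/2, m₋ = g₀₀/(2g₊₊) = −m₊, n₊ = 2 − g₀₀/(2g₊₊) = −n₋. -/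
open Complex

noncomputable section

/-- The classical (`q = 1`) conditions on a left `SU₂`-invariant, right circle-invariant
covariant derivative with Christoffel data `(n₊, n₋, m₊, m₋, r, ν, μ)` for the diagonal
Hermitian metric `(g₊₊, g₀₀, g₋₋)`: star preservation, metric preservation and vanishing
torsion. -/
def ClassicalLC (gpp g00 gmm : ℝ) (np nm mp mm r ν μ : ℂ) : Prop :=
  -- star preservation
  (r = -(starRingEnd ℂ) r ∧ nm = -(starRingEnd ℂ) np ∧ mm = -(starRingEnd ℂ) mp ∧
    ν = -(starRingEnd ℂ) μ) ∧
  -- metric preservation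
  ((starRingEnd ℂ) np = np ∧ (starRingEnd ℂ) nm = nm ∧ (starRingEnd ℂ) r = r ∧
    (gpp : ℂ) * (starRingEnd ℂ) mp = (g00 : ℂ) * μ ∧
    (g00 : ℂ) * (starRingEnd ℂ) ν = (gmm : ℂ) * mm) ∧
  -- vanishing torsion
  (mp - np + 2 = 0 ∧ mm - nm - 2 = 0 ∧ ν - μ - 1 = 0)

/-- The Christoffel data of a classical Levi-Civita connection are determined by the metric. -/
theorem ClassicalLC.christoffel_eq {gpp g00 gmm : ℝ} {np nm mp mm r ν μ : ℂ}
    (h : ClassicalLC gpp g00 gmm np nm mp mm r ν μ) (hgpp : gpp ≠ 0) (hg00 : g00 ≠ 0) :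
    r = 0 ∧ ν = 1 / 2 ∧ μ = -(1 / 2) ∧
      mm = (g00 : ℂ) / (2 * (gpp : ℂ)) ∧ mp = -((g00 : ℂ) / (2 * (gpp : ℂ))) ∧
      np = 2 - (g00 : ℂ) / (2 * (gpp : ℂ)) ∧
      nm = -(2 - (g00 : ℂ) / (2 * (gpp : ℂ))) := by
  obtain ⟨⟨hr, hn, hm, hν⟩, ⟨hnp, -, hr', hmet, -⟩, ht, -, ht0⟩ := h
  have hgpp' : (gpp : ℂ) ≠ 0 := mod_cast hgpp
  have hg00' : (g00 : ℂ) ≠ 0 := mod_cast hg00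
  have hmp_eq : mp = np - 2 := by linear_combination ht
  have hmp_real : (starRingEnd ℂ) mp = mp := by
    rw [hmp_eq, map_sub, hnp, Complex.conj_ofNat]
  rw [hmp_real] at hmet hm
  rw [hnp] at hn
  rw [hr'] at hr
  have hμ_real : (starRingEnd ℂ) μ = μ := by
    have hconj := congrArg (starRingEnd ℂ) hmet
    simp only [map_mul, conj_ofReal, hmp_real] at hconj
    exact mul_left_cancel₀ hg00' (hconj.symm.trans hmet)
  rw [hμ_real] at hν
  have hμ : μ = -(1 / 2) := by linear_combination (hν - ht0) / 2
  have hmp : mp = -((g00 : ℂ) / (2 * (gpp : ℂ))) := by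
    rw [hμ] at hmet
    field_simp
    linear_combination 2 * hmet
  refine ⟨by linear_combination hr / 2, by rw [hν, hμ, neg_neg], hμ, by rw [hm, hmp, neg_neg],
    hmp, by linear_combination hmp - hmp_eq, by linear_combination hn - hmp + hmp_eq⟩

/-- A classical Levi-Civita connection exists only for `g₊₊ = g₋₋`. -/
theorem ClassicalLC.gpp_eq_gmm {gpp g00 gmm : ℝ} {np nm mp mm r ν μ : ℂ}
    (h : ClassicalLC gpp g00 gmm np nm mp mm r ν μ) (hgpp : gpp ≠ 0) (hg00 : g00 ≠ 0) :
    gpp = gmm := by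
  obtain ⟨-, hν, -, hmm, -⟩ := h.christoffel_eq hgpp hg00
  have hgpp' : (gpp : ℂ) ≠ 0 := mod_cast hgpp
  have hg00' : (g00 : ℂ) ≠ 0 := mod_cast hg00
  have hmet := h.2.1.2.2.2.2
  rw [hν, hmm, map_div₀, map_one, Complex.conj_ofNat] at hmet
  field_simp at hmet
  exact_mod_cast hmet

/-- For `g₊₊ = g₋₋` the Levi-Civita Christoffel data satisfy all the conditions. -/
theorem classicalLC_of_gpp_eq_gmm {g : ℝ} (g00 : ℝ) (hg : g ≠ 0) :
    ClassicalLC g g00 g (2 - (g00 : ℂ) / (2 * (g : ℂ))) (-(2 - (g00 : ℂ) / (2 * (g : ℂ))))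
      (-((g00 : ℂ) / (2 * (g : ℂ)))) ((g00 : ℂ) / (2 * (g : ℂ))) 0 (1 / 2) (-(1 / 2)) := by
  have hg' : (g : ℂ) ≠ 0 := mod_cast hg
  simp only [ClassicalLC, map_zero, map_neg, map_sub, map_div₀, map_mul, map_one, conj_ofReal,
    Complex.conj_ofNat]
  refine ⟨⟨?_, ?_, ?_, ?_⟩, ⟨?_, ?_, ?_, ?_, ?_⟩, ?_, ?_, ?_⟩ <;>
    first | trivial | ring1 | field_simp

/-- A classical star-preserving, metric-preserving, torsion-free connection exists iff
`g₊₊ = g₋₋`, and in that case it is unique: the classical Levi-Civita connection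
`r = 0`, `ν = 1/2`, `μ = −1/2`, `m₋ = g₀₀/(2g₊₊) = −m₊`, `n₊ = 2 − g₀₀/(2g₊₊) = −n₋`. -/
theorem classical_leviCivita (gpp g00 gmm : ℝ)
    (hgpp : 0 < gpp) (hg00 : 0 < g00) (hgmm : 0 < gmm) :
    ((∃ np nm mp mm r ν μ : ℂ, ClassicalLC gpp g00 gmm np nm mp mm r ν μ) ↔
      gpp = gmm) ∧
    (∀ np nm mp mm r ν μ : ℂ, ClassicalLC gpp g00 gmm np nm mp mm r ν μ →
      r = 0 ∧ ν = 1 / 2 ∧ μ = -(1 / 2) ∧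
      mm = (g00 : ℂ) / (2 * (gpp : ℂ)) ∧ mp = -((g00 : ℂ) / (2 * (gpp : ℂ))) ∧
      np = 2 - (g00 : ℂ) / (2 * (gpp : ℂ)) ∧
      nm = -(2 - (g00 : ℂ) / (2 * (gpp : ℂ)))) := by
  refine ⟨⟨?_, ?_⟩, fun _ _ _ _ _ _ _ h => h.christoffel_eq hgpp.ne' hg00.ne'⟩
  · rintro ⟨_, _, _, _, _, _, _, h⟩
    exact h.gpp_eq_gmm hgpp.ne' hg00.ne'
  · rintro rfl
    exact ⟨_, _, _, _, _, _, _, classicalLC_of_gpp_eq_gmm g00 hgpp.ne'⟩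

end
end
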